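/- Suppose forms ω₁ = T dx + dy and ω₂ = −dx + T dy on a planar domain, with T smooth and 1+T² ≠ 0. There exists a nonvanishing common integrating factor R (i.e., d(Rω₁) = 0 and d(Rω₂) = 0) on a simply connected domain if and only if T satisfies the PDE T_xx + T_yy = 2T(T_x² + T_y²)/(1 + T²). -/

import Mathlib

/-- Partial derivative in the `x` direction. -/
noncomputable def pdx (f : ℝ × ℝ → ℝ) (p : ℝ × ℝ) : ℝ := fderiv ℝ f p (1, 0)
/-- Partial derivative in the `y` direction. -/
noncomputable def pdy (f : ℝ × ℝ → ℝ) (p : ℝ × ℝ) : ℝ := fderiv ℝ f p (0, 1)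

open Set Filter Topology

section PartialDerivatives
variable {f g : ℝ × ℝ → ℝ} {p : ℝ × ℝ} {U : Set (ℝ × ℝ)}

theorem HasFDerivAt.pdx_eq {f' : ℝ × ℝ →L[ℝ] ℝ} (hf : HasFDerivAt f f' p) :
    pdx f p = f' (1, 0) := by rw [pdx, hf.fderiv]

theorem HasFDerivAt.pdy_eq {f' : ℝ × ℝ →L[ℝ] ℝ} (hf : HasFDerivAt f f' p) :
    pdy f p = f' (0, 1) := by rw [pdy, hf.fderiv]

theorem Filter.EventuallyEq.pdx_eq (h : f =ᶠ[𝓝 p] g) : pdx f p = pdx g p := by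
  rw [pdx, pdx, h.fderiv_eq]

theorem Filter.EventuallyEq.pdy_eq (h : f =ᶠ[𝓝 p] g) : pdy f p = pdy g p := by
  rw [pdy, pdy, h.fderiv_eq]

theorem pdx_mul (hf : DifferentiableAt ℝ f p) (hg : DifferentiableAt ℝ g p) :
    pdx (fun q ↦ f q * g q) p = pdx f p * g p + f p * pdx g p := by
  rw [(hf.hasFDerivAt.fun_mul hg.hasFDerivAt).pdx_eq]
  simp [pdx]
  ring

theorem pdy_mul (hf : DifferentiableAt ℝ f p) (hg : DifferentiableAt ℝ g p) :
    pdy (fun q ↦ f q * g q) p = pdy f p * g p + f p * pdy g p := by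
  rw [(hf.hasFDerivAt.fun_mul hg.hasFDerivAt).pdy_eq]
  simp [pdy]
  ring

theorem pdx_add (hf : DifferentiableAt ℝ f p) (hg : DifferentiableAt ℝ g p) :
    pdx (fun q ↦ f q + g q) p = pdx f p + pdx g p :=
  (hf.hasFDerivAt.add hg.hasFDerivAt).pdx_eq

theorem pdy_add (hf : DifferentiableAt ℝ f p) (hg : DifferentiableAt ℝ g p) :
    pdy (fun q ↦ f q + g q) p = pdy f p + pdy g p :=
  (hf.hasFDerivAt.add hg.hasFDerivAt).pdy_eq

theorem pdx_neg : pdx (fun q ↦ -f q) p = -pdx f p := by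
  simp [pdx, fderiv_fun_neg]

theorem pdy_neg : pdy (fun q ↦ -f q) p = -pdy f p := by
  simp [pdy, fderiv_fun_neg]

theorem pdx_comp {φ : ℝ → ℝ} {φ' : ℝ} (hφ : HasDerivAt φ φ' (f p))
    (hf : DifferentiableAt ℝ f p) : pdx (fun q ↦ φ (f q)) p = φ' * pdx f p :=
  (hφ.comp_hasFDerivAt p hf.hasFDerivAt).pdx_eq

theorem pdy_comp {φ : ℝ → ℝ} {φ' : ℝ} (hφ : HasDerivAt φ φ' (f p))
    (hf : DifferentiableAt ℝ f p) : pdy (fun q ↦ φ (f q)) p = φ' * pdy f p :=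
  (hφ.comp_hasFDerivAt p hf.hasFDerivAt).pdy_eq

theorem ContDiffOn.differentiableAt_of_isOpen (hf : ContDiffOn ℝ (⊤ : ℕ∞) f U) (hU : IsOpen U)
    (hp : p ∈ U) : DifferentiableAt ℝ f p :=
  (hf.contDiffAt (hU.mem_nhds hp)).differentiableAt (by simp)

theorem ContDiffOn.differentiableAt_fderiv (hf : ContDiffOn ℝ (⊤ : ℕ∞) f U) (hU : IsOpen U)
    (hp : p ∈ U) : DifferentiableAt ℝ (fderiv ℝ f) p :=
  (((contDiffOn_infty_iff_fderiv_of_isOpen hU).1 hf).2.contDiffAt (hU.mem_nhds hp)).differentiableAt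
    (by simp)

theorem ContDiffOn.differentiableAt_pdx (hf : ContDiffOn ℝ (⊤ : ℕ∞) f U) (hU : IsOpen U)
    (hp : p ∈ U) : DifferentiableAt ℝ (pdx f) p :=
  (hf.differentiableAt_fderiv hU hp).clm_apply (differentiableAt_const _)

theorem ContDiffOn.differentiableAt_pdy (hf : ContDiffOn ℝ (⊤ : ℕ∞) f U) (hU : IsOpen U)
    (hp : p ∈ U) : DifferentiableAt ℝ (pdy f) p :=
  (hf.differentiableAt_fderiv hU hp).clm_apply (differentiableAt_const _)

theorem fderiv_fderiv_apply (hf : DifferentiableAt ℝ (fderiv ℝ f) p) (u v : ℝ × ℝ) :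
    fderiv ℝ (fun q ↦ fderiv ℝ f q v) p u = fderiv ℝ (fderiv ℝ f) p u v := by
  rw [fderiv_clm_apply hf (differentiableAt_const _)]
  simp

theorem ContDiffOn.isSymmSndFDerivAt_of_isOpen (hf : ContDiffOn ℝ (⊤ : ℕ∞) f U) (hU : IsOpen U)
    (hp : p ∈ U) : IsSymmSndFDerivAt ℝ f p :=
  (hf.contDiffAt (hU.mem_nhds hp)).isSymmSndFDerivAt
    (by rw [minSmoothness_of_isRCLikeNormedField]; exact WithTop.coe_le_coe.2 (le_top : (2 : ℕ∞) ≤ ⊤))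

theorem ContDiffOn.pdx_pdy (hf : ContDiffOn ℝ (⊤ : ℕ∞) f U) (hU : IsOpen U) (hp : p ∈ U) :
    pdx (pdy f) p = pdy (pdx f) p := by
  have h2 := hf.differentiableAt_fderiv hU hp
  change fderiv ℝ (fun q ↦ fderiv ℝ f q (0, 1)) p (1, 0)
    = fderiv ℝ (fun q ↦ fderiv ℝ f q (1, 0)) p (0, 1)
  rw [fderiv_fderiv_apply h2, fderiv_fderiv_apply h2]
  exact hf.isSymmSndFDerivAt_of_isOpen hU hp _ _

theorem pdx_pdx_mul (hf : ContDiffOn ℝ (⊤ : ℕ∞) f U) (hg : ContDiffOn ℝ (⊤ : ℕ∞) g U)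
    (hU : IsOpen U) (hp : p ∈ U) : pdx (pdx fun q ↦ f q * g q) p
      = pdx (pdx f) p * g p + 2 * (pdx f p * pdx g p) + f p * pdx (pdx g) p := by
  have h : pdx (fun q ↦ f q * g q) =ᶠ[𝓝 p] fun q ↦ pdx f q * g q + f q * pdx g q := by
    filter_upwards [hU.mem_nhds hp] with q hq
    exact pdx_mul (hf.differentiableAt_of_isOpen hU hq) (hg.differentiableAt_of_isOpen hU hq)
  have hf0 := hf.differentiableAt_of_isOpen hU hp
  have hg0 := hg.differentiableAt_of_isOpen hU hp
  have hf1 := hf.differentiableAt_pdx hU hp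
  have hg1 := hg.differentiableAt_pdx hU hp
  rw [h.pdx_eq, pdx_add (hf1.fun_mul hg0) (hf0.fun_mul hg1), pdx_mul hf1 hg0, pdx_mul hf0 hg1]
  ring

theorem pdy_pdy_mul (hf : ContDiffOn ℝ (⊤ : ℕ∞) f U) (hg : ContDiffOn ℝ (⊤ : ℕ∞) g U)
    (hU : IsOpen U) (hp : p ∈ U) : pdy (pdy fun q ↦ f q * g q) p
      = pdy (pdy f) p * g p + 2 * (pdy f p * pdy g p) + f p * pdy (pdy g) p := by
  have h : pdy (fun q ↦ f q * g q) =ᶠ[𝓝 p] fun q ↦ pdy f q * g q + f q * pdy g q := by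
    filter_upwards [hU.mem_nhds hp] with q hq
    exact pdy_mul (hf.differentiableAt_of_isOpen hU hq) (hg.differentiableAt_of_isOpen hU hq)
  have hf0 := hf.differentiableAt_of_isOpen hU hp
  have hg0 := hg.differentiableAt_of_isOpen hU hp
  have hf1 := hf.differentiableAt_pdy hU hp
  have hg1 := hg.differentiableAt_pdy hU hp
  rw [h.pdy_eq, pdy_add (hf1.fun_mul hg0) (hf0.fun_mul hg1), pdy_mul hf1 hg0, pdy_mul hf0 hg1]
  ring

/-- Both components of a solution of the Cauchy-Riemann equations are harmonic. -/
theorem laplacian_eq_zero_of_cauchyRiemann (hU : IsOpen U) (hf : ContDiffOn ℝ (⊤ : ℕ∞) f U)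
    (hx : ∀ q ∈ U, pdx g q = -pdy f q) (hy : ∀ q ∈ U, pdy g q = pdx f q) (hp : p ∈ U) :
    pdx (pdx g) p + pdy (pdy g) p = 0 := by
  have h1 : pdx g =ᶠ[𝓝 p] fun q ↦ -pdy f q := by
    filter_upwards [hU.mem_nhds hp] with q hq using hx q hq
  have h2 : pdy g =ᶠ[𝓝 p] pdx f := by
    filter_upwards [hU.mem_nhds hp] with q hq using hy q hq
  rw [h1.pdx_eq, h2.pdy_eq, pdx_neg, hf.pdx_pdy hU hp]
  ring

theorem pdx_pdx_arctan (hf : ContDiffOn ℝ (⊤ : ℕ∞) f U) (hU : IsOpen U) (hp : p ∈ U) :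
    pdx (pdx fun q ↦ Real.arctan (f q)) p
      = (pdx (pdx f) p * (1 + f p ^ 2) - 2 * f p * pdx f p ^ 2) / (1 + f p ^ 2) ^ 2 := by
  have h : pdx (fun q ↦ Real.arctan (f q)) =ᶠ[𝓝 p] fun q ↦ (1 / (1 + f q ^ 2)) * pdx f q := by
    filter_upwards [hU.mem_nhds hp] with q hq
    exact pdx_comp (Real.hasDerivAt_arctan _) (hf.differentiableAt_of_isOpen hU hq)
  have hf0 := hf.differentiableAt_of_isOpen hU hp
  have hpos : 1 + f p ^ 2 ≠ 0 := by positivity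
  have hφ : HasDerivAt (fun t : ℝ ↦ 1 / (1 + t ^ 2)) (-(2 * f p) / (1 + f p ^ 2) ^ 2) (f p) := by
    simpa using (((hasDerivAt_id (f p)).pow 2).const_add 1).fun_inv hpos
  have hd : DifferentiableAt ℝ (fun q ↦ 1 / (1 + f q ^ 2)) p :=
    hφ.differentiableAt.fun_comp' p hf0
  rw [h.pdx_eq, pdx_mul hd (hf.differentiableAt_pdx hU hp), pdx_comp hφ hf0]
  field_simp
  ring

theorem pdy_pdy_arctan (hf : ContDiffOn ℝ (⊤ : ℕ∞) f U) (hU : IsOpen U) (hp : p ∈ U) :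
    pdy (pdy fun q ↦ Real.arctan (f q)) p
      = (pdy (pdy f) p * (1 + f p ^ 2) - 2 * f p * pdy f p ^ 2) / (1 + f p ^ 2) ^ 2 := by
  have h : pdy (fun q ↦ Real.arctan (f q)) =ᶠ[𝓝 p] fun q ↦ (1 / (1 + f q ^ 2)) * pdy f q := by
    filter_upwards [hU.mem_nhds hp] with q hq
    exact pdy_comp (Real.hasDerivAt_arctan _) (hf.differentiableAt_of_isOpen hU hq)
  have hf0 := hf.differentiableAt_of_isOpen hU hp
  have hpos : 1 + f p ^ 2 ≠ 0 := by positivity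
  have hφ : HasDerivAt (fun t : ℝ ↦ 1 / (1 + t ^ 2)) (-(2 * f p) / (1 + f p ^ 2) ^ 2) (f p) := by
    simpa using (((hasDerivAt_id (f p)).pow 2).const_add 1).fun_inv hpos
  have hd : DifferentiableAt ℝ (fun q ↦ 1 / (1 + f q ^ 2)) p :=
    hφ.differentiableAt.fun_comp' p hf0
  rw [h.pdy_eq, pdy_mul hd (hf.differentiableAt_pdy hU hp), pdy_comp hφ hf0]
  field_simp
  ring

end PartialDerivatives

/-- Functions on an open cover of a simply connected space whose differences are locally constant
agree, up to locally constant functions, with a single global function. -/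
theorem exists_global_of_locallyConstant_sub {X ι G : Type*} [TopologicalSpace X]
    [SimplyConnectedSpace X] [LocallyPathConnectedSpace X] [AddCommGroup G]
    (W : ι → Set X) (hWo : ∀ i, IsOpen (W i)) (hW : ∀ x, ∃ i, x ∈ W i) (f : ι → X → G)
    (hf : ∀ i j, ∀ x ∈ W i ∩ W j, ∀ᶠ y in 𝓝 x, f i y - f j y = f i x - f j x) :
    ∃ g : X → G, ∀ i, ∀ x ∈ W i, ∀ᶠ y in 𝓝 x, g y - f i y = g x - f i x := by
  choose idx hidx using hW
  let _ : TopologicalSpace G := ⊥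
  have : DiscreteTopology G := ⟨rfl⟩
  let Z : FiberBundleCore ι X G :=
    { baseSet := W
      isOpen_baseSet := hWo
      indexAt := idx
      mem_baseSet_at := hidx
      coordChange := fun i j x v ↦ v + (f i x - f j x)
      coordChange_self := by simp
      continuousOn_coordChange := by
        rintro i j ⟨x, v⟩ ⟨hx, -⟩
        apply ContinuousAt.continuousWithinAt
        refine ContinuousAt.add continuousAt_snd ?_
        have h : ContinuousAt (fun y ↦ f i y - f j y) x :=
          continuousAt_const.congr ((hf i j x hx).mono fun y hy ↦ hy.symm)
        exact h.comp (x := (x, v)) continuousAt_fst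
      coordChange_comp := by intros; abel }
  have hcov : IsCoveringMap (Bundle.TotalSpace.proj : Bundle.TotalSpace G Z.Fiber → X) := by
    exact FiberBundle.isCoveringMap (F := G) (E := Z.Fiber)
  obtain ⟨x₀⟩ : Nonempty X := inferInstance
  obtain ⟨s, ⟨-, hs⟩, -⟩ := hcov.existsUnique_continuousMap_lifts (ContinuousMap.id X) x₀
    (⟨x₀, (0 : G)⟩ : Bundle.TotalSpace G Z.Fiber) rfl
  have hproj : ∀ x, (s x).proj = x := fun x ↦ congrFun hs x
  let c : X → G := fun x ↦ (s x).2
  refine ⟨fun x ↦ c x + f (idx x) x, fun i x hx ↦ ?_⟩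
  have hc : ContinuousAt (fun y ↦ (Z.localTriv i (s y)).2) x := by
    refine continuousAt_snd.comp (ContinuousAt.comp (g := Z.localTriv i) ?_ s.continuous.continuousAt)
    apply (Z.localTriv i).continuousAt
    rw [Z.mem_localTriv_source, hproj]
    exact hx
  have h : ∀ y, (Z.localTriv i (s y)).2 = c y + f (idx y) y - f i y := by
    intro y
    rw [Z.localTriv_apply]
    change c y + (f (idx (s y).proj) (s y).proj - f i (s y).proj) = _
    rw [hproj]
    exact (add_sub_assoc _ _ _).symm
  filter_upwards [hc.eventually ((isOpen_discrete {_}).mem_nhds rfl)] with y hy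
  exact (h y).symm.trans (hy.trans (h x))

/-- The Poincaré lemma for 1-forms on a simply connected open set. -/
theorem exists_forall_hasFDerivAt_of_isSimplyConnected
    {E F : Type*} [NormedAddCommGroup E] [NormedSpace ℝ E] [NormedAddCommGroup F]
    [NormedSpace ℝ F] [CompleteSpace F] {U : Set E} (hU : IsOpen U) (hsc : SimplyConnectedSpace U)
    {ω : E → E →L[ℝ] F} (hω : DifferentiableOn ℝ ω U)
    (hdω : ∀ a ∈ U, ∀ x y, fderiv ℝ ω a x y = fderiv ℝ ω a y x) :
    ∃ f : E → F, ∀ a ∈ U, HasFDerivAt f (ω a) a := by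
  classical
  have := hU.locallyPathConnectedSpace
  choose r hr0 hrU using fun x : U ↦ Metric.isOpen_iff.1 hU x x.2
  choose f hf using fun x : U ↦
    (convex_ball (x : E) (r x)).exists_forall_hasFDerivAt_of_fderiv_symmetric Metric.isOpen_ball
      (hω.mono (hrU x)) fun a ha ↦ hdω a (hrU x ha)
  obtain ⟨g, hg⟩ := exists_global_of_locallyConstant_sub (X := U)
    (fun x : U ↦ (↑) ⁻¹' Metric.ball (x : E) (r x))
    (fun x ↦ Metric.isOpen_ball.preimage continuous_subtype_val)
    (fun x ↦ ⟨x, Metric.mem_ball_self (hr0 x)⟩) (fun x y ↦ f x y) (by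
      rintro i j x ⟨hi, hj⟩
      have h : ∀ᶠ y in 𝓝 (x : E), f i y - f j y = f i x - f j x := by
        have hconv := (convex_ball (i : E) (r i)).inter (convex_ball (j : E) (r j))
        have hopen : IsOpen (Metric.ball (i : E) (r i) ∩ Metric.ball (j : E) (r j)) :=
          Metric.isOpen_ball.inter Metric.isOpen_ball
        have hd : ∀ y ∈ Metric.ball (i : E) (r i) ∩ Metric.ball (j : E) (r j),
            HasFDerivAt (fun z ↦ f i z - f j z) 0 y := fun y hy ↦ by
          have h := (hf i y hy.1).sub (hf j y hy.2)
          rwa [sub_self] at h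
        filter_upwards [hopen.mem_nhds ⟨hi, hj⟩] with y hy
        exact hconv.is_const_of_fderivWithin_eq_zero (𝕜 := ℝ)
          (fun z hz ↦ (hd z hz).differentiableAt.differentiableWithinAt)
          (fun z hz ↦ (hd z hz).hasFDerivWithinAt.fderivWithin (hopen.uniqueDiffOn z hz))
          hy ⟨hi, hj⟩
      exact continuous_subtype_val.continuousAt.eventually h)
  refine ⟨fun p ↦ if h : p ∈ U then g ⟨p, h⟩ else 0, fun a ha ↦ ?_⟩
  have hloc := hg ⟨a, ha⟩ ⟨a, ha⟩ (Metric.mem_ball_self (hr0 _))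
  rw [nhds_subtype_eq_comap, eventually_comap] at hloc
  refine ((hf ⟨a, ha⟩ a (Metric.mem_ball_self (hr0 _))).add_const
    (g ⟨a, ha⟩ - f ⟨a, ha⟩ a)).congr_of_eventuallyEq ?_
  filter_upwards [hloc, hU.mem_nhds ha] with y hy hyU
  simp only [dif_pos hyU, ← hy ⟨y, hyU⟩ rfl]
  abel

/-- A harmonic function on a simply connected planar open set has a harmonic conjugate. -/
theorem exists_harmonic_conjugate {U : Set (ℝ × ℝ)} (hU : IsOpen U) (hsc : SimplyConnectedSpace U)
    {θ : ℝ × ℝ → ℝ} (hθ : ContDiffOn ℝ (⊤ : ℕ∞) θ U)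
    (hlap : ∀ p ∈ U, pdx (pdx θ) p + pdy (pdy θ) p = 0) :
    ∃ h : ℝ × ℝ → ℝ, ContDiffOn ℝ (⊤ : ℕ∞) h U ∧
      ∀ p ∈ U, pdx h p = pdy θ p ∧ pdy h p = -pdx θ p := by
  let J : ℝ × ℝ →L[ℝ] ℝ × ℝ :=
    (-ContinuousLinearMap.snd ℝ ℝ ℝ).prod (ContinuousLinearMap.fst ℝ ℝ ℝ)
  have hJ : ∀ v, J v = (-v.2, v.1) := fun v ↦ rfl
  have hθ' : ContDiffOn ℝ (⊤ : ℕ∞) (fderiv ℝ θ) U :=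
    ((contDiffOn_infty_iff_fderiv_of_isOpen hU).1 hθ).2
  have hω : ContDiffOn ℝ (⊤ : ℕ∞) (fun p ↦ (fderiv ℝ θ p).comp J) U :=
    hθ'.clm_comp contDiffOn_const
  obtain ⟨h, hh⟩ := exists_forall_hasFDerivAt_of_isSimplyConnected hU hsc
    (hω.differentiableOn (by simp)) (by
      intro a ha u v
      have hd := hθ.differentiableAt_fderiv hU ha
      have hderiv : ∀ u v, fderiv ℝ (fun p ↦ (fderiv ℝ θ p).comp J) a u v
          = fderiv ℝ (fderiv ℝ θ) a u (J v) := by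
        intro u v
        rw [fderiv_clm_comp hd (differentiableAt_const _)]
        simp
      have hl : fderiv ℝ (fderiv ℝ θ) a (1, 0) (1, 0)
          + fderiv ℝ (fderiv ℝ θ) a (0, 1) (0, 1) = 0 := by
        rw [← fderiv_fderiv_apply hd, ← fderiv_fderiv_apply hd]
        exact hlap a ha
      have hs := hθ.isSymmSndFDerivAt_of_isOpen hU ha (1, 0) (0, 1)
      have hbasis : ∀ w : ℝ × ℝ, w = w.1 • (1, 0) + w.2 • (0, 1) := fun w ↦ by simp
      rw [hderiv, hderiv, hbasis (J v), hbasis (J u), hbasis u, hbasis v]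
      simp only [hJ, map_add, map_smul, add_apply,
        smul_apply, smul_eq_mul, Prod.fst_add, Prod.snd_add, Prod.smul_fst,
        Prod.smul_snd]
      rw [hs]
      linear_combination (u.2 * v.1 - u.1 * v.2) * hl)
  refine ⟨h, (contDiffOn_infty_iff_fderiv_of_isOpen hU).2
    ⟨fun p hp ↦ (hh p hp).differentiableAt.differentiableWithinAt,
      hω.congr fun p hp ↦ (hh p hp).fderiv⟩, fun p hp ↦ ⟨?_, ?_⟩⟩
  · rw [(hh p hp).pdx_eq]
    simp [hJ, pdy]
  · rw [(hh p hp).pdy_eq]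
    rw [pdx, ← map_neg]
    simp [hJ]

/-- For `ω₁ = T dx + dy` and `ω₂ = −dx + T dy` on a simply connected planar
domain, a nonvanishing common integrating factor `R` (with `d(Rω₁) = d(Rω₂) = 0`)
exists if and only if `T_xx + T_yy = 2T(T_x² + T_y²)/(1+T²)`.
Closedness of `Rω₁ = RT dx + R dy` reads `∂_y(RT) = ∂_x R`, and closedness of
`Rω₂ = −R dx + RT dy` reads `∂_y(−R) = ∂_x(RT)`. -/
theorem integrating_factor_iff_conformally_flat
    (U : Set (ℝ × ℝ)) (hU : IsOpen U) (hne : U.Nonempty)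
    (hsc : SimplyConnectedSpace U)
    (T : ℝ × ℝ → ℝ) (hT : ContDiffOn ℝ (⊤ : ℕ∞) T U) :
    (∃ R : ℝ × ℝ → ℝ, ContDiffOn ℝ (⊤ : ℕ∞) R U ∧ (∀ p ∈ U, R p ≠ 0) ∧
      (∀ p ∈ U, pdy (fun q => R q * T q) p = pdx R p) ∧
      (∀ p ∈ U, pdy (fun q => -R q) p = pdx (fun q => R q * T q) p)) ↔
    (∀ p ∈ U, (pdx (pdx T) p + pdy (pdy T) p) * (1 + (T p) ^ 2)
        = 2 * T p * ((pdx T p) ^ 2 + (pdy T p) ^ 2)) := by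
  constructor
  · rintro ⟨R, hR, hR0, h1, h2⟩ p hp
    have hRd := hR.differentiableAt_of_isOpen hU hp
    have hTd := hT.differentiableAt_of_isOpen hU hp
    have h2' : ∀ q ∈ U, pdx (fun q ↦ R q * T q) q = -pdy R q := fun q hq ↦ by
      rw [← h2 q hq, pdy_neg]
    have hlapP := laplacian_eq_zero_of_cauchyRiemann hU hR h2' h1 hp
    have hlapR := laplacian_eq_zero_of_cauchyRiemann (g := fun q ↦ -R q) hU (hR.mul hT)
      (fun q hq ↦ by rw [pdx_neg]; exact congrArg Neg.neg (h1 q hq).symm) h2 hp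
    have hxx : pdx (pdx fun q ↦ -R q) p = -pdx (pdx R) p := by
      rw [funext fun q ↦ pdx_neg (f := R) (p := q), pdx_neg]
    have hyy : pdy (pdy fun q ↦ -R q) p = -pdy (pdy R) p := by
      rw [funext fun q ↦ pdy_neg (f := R) (p := q), pdy_neg]
    rw [hxx, hyy] at hlapR
    rw [pdx_pdx_mul hR hT hU hp, pdy_pdy_mul hR hT hU hp] at hlapP
    have e1 := h1 p hp
    have e2 := h2' p hp
    rw [pdy_mul hRd hTd] at e1
    rw [pdx_mul hRd hTd] at e2
    have hRx : (1 + T p ^ 2) * pdx R p = R p * (pdy T p - T p * pdx T p) := by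
      linear_combination T p * e2 - e1
    have hRy : (1 + T p ^ 2) * pdy R p = -R p * (pdx T p + T p * pdy T p) := by
      linear_combination T p * e1 + e2
    apply mul_left_cancel₀ (hR0 p hp)
    linear_combination (1 + T p ^ 2) * hlapP + T p * (1 + T p ^ 2) * hlapR
      - 2 * pdx T p * hRx - 2 * pdy T p * hRy
  · intro hpde
    have hθ : ContDiffOn ℝ (⊤ : ℕ∞) (fun q ↦ Real.arctan (T q)) U :=
      Real.contDiff_arctan.comp_contDiffOn hT
    obtain ⟨h, hh, hconj⟩ := exists_harmonic_conjugate hU hsc hθ (by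
      intro p hp
      rw [pdx_pdx_arctan hT hU hp, pdy_pdy_arctan hT hU hp, ← add_div, div_eq_zero_iff]
      left
      linear_combination hpde p hp)
    set θ : ℝ × ℝ → ℝ := fun q ↦ Real.arctan (T q) with hθdef
    have hcos : ∀ q, Real.cos (θ q) ≠ 0 := fun q ↦ (Real.cos_arctan_pos _).ne'
    have hRT : (fun q ↦ Real.exp (h q) * Real.cos (θ q) * T q)
        = fun q ↦ Real.exp (h q) * Real.sin (θ q) := by
      funext q
      have : T q = Real.sin (θ q) / Real.cos (θ q) := by
        rw [← Real.tan_eq_sin_div_cos, hθdef, Real.tan_arctan]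
      rw [this]
      field_simp [hcos q]
    refine ⟨fun q ↦ Real.exp (h q) * Real.cos (θ q), hh.exp.mul hθ.cos,
      fun p _ ↦ mul_ne_zero (Real.exp_ne_zero _) (hcos p), fun p hp ↦ ?_, fun p hp ↦ ?_⟩
    all_goals
      have hhd := hh.differentiableAt_of_isOpen hU hp
      have hθd := hθ.differentiableAt_of_isOpen hU hp
      obtain ⟨hx, hy⟩ := hconj p hp
      rw [hRT]
    · rw [pdy_mul hhd.exp hθd.sin, pdx_mul hhd.exp hθd.cos,
        pdy_comp (Real.hasDerivAt_exp _) hhd, pdx_comp (Real.hasDerivAt_exp _) hhd,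
        pdy_comp (Real.hasDerivAt_sin _) hθd, pdx_comp (Real.hasDerivAt_cos _) hθd, hx, hy]
      ring
    · rw [pdy_neg, pdx_mul hhd.exp hθd.sin, pdy_mul hhd.exp hθd.cos,
        pdy_comp (Real.hasDerivAt_exp _) hhd, pdx_comp (Real.hasDerivAt_exp _) hhd,
        pdx_comp (Real.hasDerivAt_sin _) hθd, pdy_comp (Real.hasDerivAt_cos _) hθd, hx, hy]
      ring
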